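/- arXiv:1503.00253 — 8 statements merged into one kernel-verified Lean document; each statement's English description precedes it below -/
import Mathlib

section
/- Let U be an n×n complex unitary matrix, let w ∈ ℂⁿ be a unit vector, and define the linear map T : ℂⁿ → ℂⁿ by T v = U (v - ⟨w, v⟩ w) (i.e. U composed with the orthogonal projection onto the orthogonal complement of w). If ψ ∈ ℂⁿ is a unit vector and η ∈ ℂ satisfy T ψ = η ψ, then |η|² = 1 - |⟨w, ψ⟩|². In particular |η| ≤ 1, and |η| < 1 unless ⟨w, ψ⟩ = 0. -/
open Matrix Complex

/-- A matrix with `Uᴴ * U = 1` preserves the Hermitian form. -/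
theorem star_mulVec_dotProduct_mulVec_of_conjTranspose_mul_self {m n R : Type*} [Fintype m]
    [Fintype n] [DecidableEq n] [CommSemiring R] [StarRing R] {U : Matrix m n R}
    (hU : Uᴴ * U = 1) (v w : n → R) : star (U *ᵥ v) ⬝ᵥ (U *ᵥ w) = star v ⬝ᵥ w := by
  rw [star_mulVec, ← dotProduct_mulVec, mulVec_mulVec, hU, one_mulVec]

/-- Pythagoras: removing from `v` its component along a unit vector `w` lowers the squared norm
by the squared modulus of that component. -/
theorem star_dotProduct_self_sub_smul {n R : Type*} [Fintype n] [CommRing R] [StarRing R]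
    {w : n → R} (hw : star w ⬝ᵥ w = 1) (v : n → R) :
    star (v - (star w ⬝ᵥ v) • w) ⬝ᵥ (v - (star w ⬝ᵥ v) • w) =
      star v ⬝ᵥ v - star (star w ⬝ᵥ v) * (star w ⬝ᵥ v) := by
  have hvw : star v ⬝ᵥ w = star (star w ⬝ᵥ v) := star_dotProduct v w
  simp only [star_sub, star_smul, sub_dotProduct, dotProduct_sub, smul_dotProduct,
    dotProduct_smul, smul_eq_mul, hw, hvw]
  ring

/-- An n×n unitary matrix composed with the orthogonal projection onto the orthogonal
complement of a unit vector `w` has all eigenvalues in the closed unit disk, with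
`|η|² = 1 - |⟨w, ψ⟩|²` for a unit eigenvector `ψ`. -/
theorem eigenvalue_modulus_of_projected_unitary {n : ℕ}
    (U : Matrix (Fin n) (Fin n) ℂ) (hU : Uᴴ * U = 1)
    (w : Fin n → ℂ) (hw : star w ⬝ᵥ w = 1)
    (ψ : Fin n → ℂ) (hψ : star ψ ⬝ᵥ ψ = 1)
    (η : ℂ)
    (hEig : U.mulVec (ψ - (star w ⬝ᵥ ψ) • w) = η • ψ) :
    ‖η‖ ^ 2 = 1 - ‖star w ⬝ᵥ ψ‖ ^ 2 ∧ ‖η‖ ≤ 1 ∧ (star w ⬝ᵥ ψ ≠ 0 → ‖η‖ < 1) := by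
  have key : star η * η = 1 - star (star w ⬝ᵥ ψ) * (star w ⬝ᵥ ψ) := by
    rw [← hψ, ← star_dotProduct_self_sub_smul hw,
      ← star_mulVec_dotProduct_mulVec_of_conjTranspose_mul_self hU, hEig, star_smul,
      smul_dotProduct, dotProduct_smul, hψ, smul_eq_mul, smul_eq_mul, mul_one]
  have hη : ‖η‖ ^ 2 = 1 - ‖star w ⬝ᵥ ψ‖ ^ 2 := by
    simp only [star_def, conj_mul'] at key
    exact_mod_cast key
  refine ⟨hη, ?_, fun h => ?_⟩
  · nlinarith [sq_nonneg ‖star w ⬝ᵥ ψ‖, norm_nonneg η]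
  · nlinarith [pow_pos (norm_pos_iff.mpr h) 2, norm_nonneg η]
end

section
/- Fix s, m : ℕ with s + m ≥ 1, complex numbers η₁, …, η_m with |η_i| < 1 for all i, and g₀ ∈ ℂ with |g₀| = 1. Define polynomials f(z) = z^s ∏_{i=1}^m (z - η_i) and g(z) = g₀ ∏_{i=1}^m (1 - z · conj(η_i)). Then for every α ∈ ℂ with |α| = 1, every complex root z of f(z) + α g(z) satisfies |z| = 1. -/
open Complex

theorem prod_lt_prod_of_nonneg_of_nonempty {ι : Type*} {t : Finset ι} (ht : t.Nonempty)
    {a b : ι → ℝ} (ha : ∀ i, 0 ≤ a i) (hab : ∀ i, a i < b i) :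
    ∏ i ∈ t, a i < ∏ i ∈ t, b i := by
  induction ht using Finset.Nonempty.cons_induction with
  | singleton i => simpa using hab i
  | cons i t hi _ ih =>
    rw [Finset.prod_cons, Finset.prod_cons]
    exact mul_lt_mul'' (hab i) ih (ha i) (Finset.prod_nonneg fun j _ => ha j)

theorem pow_mul_prod_lt_prod {s m : ℕ} (hsm : 1 ≤ s + m) {r : ℝ} (hr₀ : 0 ≤ r) (hr₁ : r < 1)
    {a b : Fin m → ℝ} (ha : ∀ i, 0 ≤ a i) (hab : ∀ i, a i < b i) :
    r ^ s * ∏ i, a i < ∏ i, b i := by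
  rcases Nat.eq_zero_or_pos m with rfl | hm
  · simpa using pow_lt_one₀ hr₀ hr₁ (by omega : s ≠ 0)
  · calc r ^ s * ∏ i, a i ≤ ∏ i, a i :=
          mul_le_of_le_one_left (Finset.prod_nonneg fun i _ => ha i) (pow_le_one₀ hr₀ hr₁.le)
      _ < ∏ i, b i :=
          prod_lt_prod_of_nonneg_of_nonempty ⟨⟨0, hm⟩, Finset.mem_univ _⟩ ha hab

theorem norm_one_sub_mul_conj_sq_sub_norm_sub_sq (z w : ℂ) :
    ‖1 - z * (starRingEnd ℂ) w‖ ^ 2 - ‖z - w‖ ^ 2 = (1 - ‖z‖ ^ 2) * (1 - ‖w‖ ^ 2) := by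
  simp only [Complex.sq_norm, Complex.normSq_apply, Complex.sub_re, Complex.sub_im,
    Complex.mul_re, Complex.mul_im, Complex.one_re, Complex.one_im, Complex.conj_re,
    Complex.conj_im]
  ring

theorem norm_sub_lt_norm_one_sub_mul_conj {z w : ℂ} (hz : ‖z‖ < 1) (hw : ‖w‖ < 1) :
    ‖z - w‖ < ‖1 - z * (starRingEnd ℂ) w‖ := by
  refine lt_of_pow_lt_pow_left₀ 2 (norm_nonneg _) (sub_pos.1 ?_)
  rw [norm_one_sub_mul_conj_sq_sub_norm_sub_sq]
  exact mul_pos (sub_pos.2 (pow_lt_one₀ (norm_nonneg _) hz two_ne_zero))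
    (sub_pos.2 (pow_lt_one₀ (norm_nonneg _) hw two_ne_zero))

theorem norm_one_sub_mul_conj_lt_norm_sub {z w : ℂ} (hz : 1 < ‖z‖) (hw : ‖w‖ < 1) :
    ‖1 - z * (starRingEnd ℂ) w‖ < ‖z - w‖ := by
  refine lt_of_pow_lt_pow_left₀ 2 (norm_nonneg _) (sub_neg.1 ?_)
  rw [norm_one_sub_mul_conj_sq_sub_norm_sub_sq]
  exact mul_neg_of_neg_of_pos (sub_neg.2 (one_lt_pow₀ hz two_ne_zero))
    (sub_pos.2 (pow_lt_one₀ (norm_nonneg _) hw two_ne_zero))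

/-- If `f(z) = z^s ∏ (z - ηᵢ)` with all `|ηᵢ| < 1`, `g(z) = g₀ ∏ (1 - z·conj ηᵢ)` with
`|g₀| = 1`, and `|α| = 1`, then every root of `f + α g` lies on the unit circle. -/
theorem roots_on_unit_circle (s m : ℕ) (hsm : 1 ≤ s + m)
    (η : Fin m → ℂ) (hη : ∀ i, ‖η i‖ < 1)
    (g₀ : ℂ) (hg₀ : ‖g₀‖ = 1) (α : ℂ) (hα : ‖α‖ = 1) (z : ℂ)
    (hroot : z ^ s * ∏ i, (z - η i)
        + α * (g₀ * ∏ i, (1 - z * (starRingEnd ℂ) (η i))) = 0) :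
    ‖z‖ = 1 := by
  have hnorm : ‖z‖ ^ s * ∏ i, ‖z - η i‖ = ∏ i, ‖1 - z * (starRingEnd ℂ) (η i)‖ := by
    simpa only [norm_neg, norm_mul, norm_pow, norm_prod, hα, hg₀, one_mul] using
      congrArg norm (eq_neg_of_add_eq_zero_left hroot)
  rcases lt_trichotomy ‖z‖ 1 with hz | hz | hz
  · exact absurd hnorm (pow_mul_prod_lt_prod hsm (norm_nonneg z) hz (fun _ => norm_nonneg _)
      fun i => norm_sub_lt_norm_one_sub_mul_conj hz (hη i)).ne
  · exact hz
  · have hlt := pow_mul_prod_lt_prod hsm (inv_nonneg.2 (norm_nonneg z)) (inv_lt_one_of_one_lt₀ hz)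
      (fun _ => norm_nonneg _) fun i => norm_one_sub_mul_conj_lt_norm_sub hz (hη i)
    have hz₀ : ‖z‖ ^ s ≠ 0 := pow_ne_zero s (zero_lt_one.trans hz).ne'
    rw [← hnorm, inv_pow, inv_mul_cancel_left₀ hz₀] at hlt
    exact absurd hlt (lt_irrefl _)
end

section
/- Fix s, m : ℕ with s + m ≥ 1, complex numbers η₁, …, η_m with |η_i| < 1 for all i, and g₀ ∈ ℂ with |g₀| = 1. Define polynomials f(z) = z^s ∏_{i=1}^m (z - η_i) and g(z) = g₀ ∏_{i=1}^m (1 - z · conj(η_i)). Then for every λ ∈ ℂ with |λ| = 1: g(λ) ≠ 0, |f(λ)| = |g(λ)|, and α := -f(λ)/g(λ) is the unique complex number satisfying f(λ) + α g(λ) = 0; moreover |α| = 1. -/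
open Complex

/-- On the unit circle, a linear factor and its reciprocal have the same norm. -/
theorem norm_one_sub_mul_conj_of_norm_eq_one {z : ℂ} (hz : ‖z‖ = 1) (w : ℂ) :
    ‖1 - z * (starRingEnd ℂ) w‖ = ‖z - w‖ := by
  have h : 1 - z * (starRingEnd ℂ) w = z * (starRingEnd ℂ) (z - w) := by
    rw [map_sub, mul_sub, Complex.mul_conj, Complex.normSq_eq_norm_sq, hz]
    simp
  rw [h, norm_mul, hz, one_mul, Complex.norm_conj]

/-- Any prescribed eigenvalue `λ` on the unit circle can be induced by a unique choice of the
feedback amplitude `α`: with `f(z) = z^s ∏ (z - ηᵢ)` (`|ηᵢ| < 1`) and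
`g(z) = g₀ ∏ (1 - z·conj ηᵢ)` (`|g₀| = 1`), for `|λ| = 1` we have `g(λ) ≠ 0`,
`|f(λ)| = |g(λ)|`, `α = -f(λ)/g(λ)` is the unique solution of `f(λ) + α g(λ) = 0`,
and `|α| = 1`. -/
theorem unique_feedback_phase (s m : ℕ) (hsm : 1 ≤ s + m)
    (η : Fin m → ℂ) (hη : ∀ i, ‖η i‖ < 1)
    (g₀ : ℂ) (hg₀ : ‖g₀‖ = 1) (lam : ℂ) (hlam : ‖lam‖ = 1) :
    (g₀ * ∏ i, (1 - lam * (starRingEnd ℂ) (η i))) ≠ 0 ∧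
    ‖lam ^ s * ∏ i, (lam - η i)‖ = ‖g₀ * ∏ i, (1 - lam * (starRingEnd ℂ) (η i))‖ ∧
    (∀ α : ℂ,
      lam ^ s * ∏ i, (lam - η i)
          + α * (g₀ * ∏ i, (1 - lam * (starRingEnd ℂ) (η i))) = 0 ↔
        α = -(lam ^ s * ∏ i, (lam - η i))
              / (g₀ * ∏ i, (1 - lam * (starRingEnd ℂ) (η i)))) ∧
    ‖-(lam ^ s * ∏ i, (lam - η i))
        / (g₀ * ∏ i, (1 - lam * (starRingEnd ℂ) (η i)))‖ = 1 := by
  have hnorm : ‖lam ^ s * ∏ i, (lam - η i)‖ =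
      ‖g₀ * ∏ i, (1 - lam * (starRingEnd ℂ) (η i))‖ := by
    simp only [norm_mul, norm_pow, norm_prod, hlam, hg₀, one_pow,
      norm_one_sub_mul_conj_of_norm_eq_one hlam]
  have hne : lam ^ s * ∏ i, (lam - η i) ≠ 0 := by
    refine mul_ne_zero (pow_ne_zero _ ?_) (Finset.prod_ne_zero_iff.2 fun i _ hi => ?_)
    · exact norm_ne_zero_iff.1 (hlam ▸ one_ne_zero)
    · exact (hη i).ne (sub_eq_zero.1 hi ▸ hlam)
  have hg : g₀ * ∏ i, (1 - lam * (starRingEnd ℂ) (η i)) ≠ 0 :=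
    norm_ne_zero_iff.1 (hnorm ▸ norm_ne_zero_iff.2 hne)
  refine ⟨hg, hnorm, fun α => ?_, ?_⟩
  · rw [eq_div_iff hg, add_comm, add_eq_zero_iff_eq_neg]
  · rw [norm_div, norm_neg, hnorm, div_self (norm_ne_zero_iff.2 hg)]
end

section
/- Fix s, m : ℕ with s + m ≥ 1, complex numbers η₁, …, η_m with |η_i| < 1 for all i, and g₀ ∈ ℂ with |g₀| = 1. Define polynomials f(z) = z^s ∏_{i=1}^m (z - η_i) and g(z) = g₀ ∏_{i=1}^m (1 - z · conj(η_i)). Then the contour integral over the positively oriented unit circle satisfies ∮_{|z|=1} ( f'(z)/f(z) - g'(z)/g(z) ) dz = 2πi (s + m). -/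
open Complex

lemma Differentiable.differentiableAt_logDeriv {g : ℂ → ℂ} (hg : Differentiable ℂ g) {z : ℂ}
    (hz : g z ≠ 0) : DifferentiableAt ℂ (logDeriv g) z :=
  hg.deriv.differentiableAt.div hg.differentiableAt hz

/-- The logarithmic derivative of an entire function without zeros in a closed disc is
holomorphic there, so its integral over the bounding circle vanishes. -/
lemma circleIntegral_logDeriv_eq_zero {g : ℂ → ℂ} (hg : Differentiable ℂ g) {c : ℂ} {R : ℝ}
    (hR : 0 ≤ R) (hg0 : ∀ z ∈ Metric.closedBall c R, g z ≠ 0) :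
    (∮ z in C(c, R), logDeriv g z) = 0 :=
  circleIntegral_eq_zero_of_differentiable_on_off_countable hR Set.countable_empty
    (fun z hz => (hg.differentiableAt_logDeriv (hg0 z hz)).continuousAt.continuousWithinAt)
    fun z hz => hg.differentiableAt_logDeriv (hg0 z (Metric.ball_subset_closedBall hz.1))

lemma circleIntegrable_sub_inv_of_mem_ball {c w : ℂ} {R : ℝ} (hw : w ∈ Metric.ball c R) :
    CircleIntegrable (fun z => (z - w)⁻¹) c R := by
  refine circleIntegrable_sub_inv_iff.2 (Or.inr fun h => ?_)
  have hR : 0 < R := dist_nonneg.trans_lt hw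
  rw [Metric.mem_sphere, abs_of_pos hR] at h
  exact (Metric.mem_ball.1 hw).ne h

/-- The logarithmic derivative of `z ^ s * ∏ (z - ηᵢ)` away from its zeros. -/
lemma logDeriv_pow_mul_prod_sub {ι : Type*} [Fintype ι] (s : ℕ) (η : ι → ℂ) {z : ℂ}
    (hz : z ≠ 0) (hη : ∀ i, z ≠ η i) :
    logDeriv (fun w : ℂ => w ^ s * ∏ i, (w - η i)) z = s * (z - 0)⁻¹ + ∑ i, (z - η i)⁻¹ := by
  have h : ∀ i, z - η i ≠ 0 := fun i => sub_ne_zero.2 (hη i)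
  have hp : ∏ i, (z - η i) ≠ 0 := Finset.prod_ne_zero_iff.2 fun i _ => h i
  rw [logDeriv_mul (f := fun w => w ^ s) (g := fun w => ∏ i, (w - η i)) z (pow_ne_zero s hz) hp
      (by fun_prop) (by fun_prop),
    logDeriv_prod (fun i _ => h i) (fun i _ => by fun_prop), logDeriv_pow]
  simp [div_eq_mul_inv, logDeriv_apply]

/-- The winding number computation for the feedback phase: with `f(z) = z^s ∏ (z - ηᵢ)`
(`|ηᵢ| < 1`) and `g(z) = g₀ ∏ (1 - z·conj ηᵢ)` (`|g₀| = 1`),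
`∮_{|z|=1} (f'/f - g'/g) dz = 2πi(s + m)`. -/
theorem winding_of_alpha (s m : ℕ) (hsm : 1 ≤ s + m)
    (η : Fin m → ℂ) (hη : ∀ i, ‖η i‖ < 1)
    (g₀ : ℂ) (hg₀ : ‖g₀‖ = 1) :
    (∮ z in C(0, 1),
        (deriv (fun w : ℂ => w ^ s * ∏ i, (w - η i)) z
            / (z ^ s * ∏ i, (z - η i))
          - deriv (fun w : ℂ => g₀ * ∏ i, (1 - w * (starRingEnd ℂ) (η i))) z
            / (g₀ * ∏ i, (1 - z * (starRingEnd ℂ) (η i)))))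
      = 2 * Real.pi * Complex.I * ((s : ℂ) + (m : ℂ)) := by
  set g : ℂ → ℂ := fun w => g₀ * ∏ i, (1 - w * (starRingEnd ℂ) (η i)) with hg
  have hgd : Differentiable ℂ g := by fun_prop
  have hg0 : ∀ z ∈ Metric.closedBall (0 : ℂ) 1, g z ≠ 0 := by
    intro z hz
    refine mul_ne_zero (norm_ne_zero_iff.1 (by simp [hg₀]))
      (Finset.prod_ne_zero_iff.2 fun i _ h => ?_)
    have h1 : ‖z‖ * ‖η i‖ = 1 := by
      rw [← RCLike.norm_conj (η i), ← norm_mul, ← sub_eq_zero.1 h, norm_one]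
    have hz1 : ‖z‖ ≤ 1 := by simpa using hz
    nlinarith [hη i, norm_nonneg z, norm_nonneg (η i)]
  have hball : ∀ i, η i ∈ Metric.ball (0 : ℂ) 1 := fun i => by simpa using hη i
  have h0 : (0 : ℂ) ∈ Metric.ball (0 : ℂ) 1 := by simp
  have hi0 : CircleIntegrable (fun z : ℂ => (s : ℂ) * (z - 0)⁻¹) 0 1 :=
    (circleIntegrable_sub_inv_of_mem_ball h0).const_smul (a := (s : ℂ))
  have hi : ∀ i ∈ Finset.univ, CircleIntegrable (fun z : ℂ => (z - η i)⁻¹) 0 1 :=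
    fun i _ => circleIntegrable_sub_inv_of_mem_ball (hball i)
  have his : CircleIntegrable (fun z : ℂ => ∑ i, (z - η i)⁻¹) 0 1 :=
    CircleIntegrable.fun_sum _ hi
  have hig : CircleIntegrable (logDeriv g) 0 1 :=
    ContinuousOn.circleIntegrable zero_le_one fun z hz =>
      (hgd.differentiableAt_logDeriv
        (hg0 z (Metric.sphere_subset_closedBall hz))).continuousAt.continuousWithinAt
  calc
    _ = ∮ z in C(0, 1), (s * (z - 0)⁻¹ + ∑ i, (z - η i)⁻¹ - logDeriv g z) := by
      refine circleIntegral.integral_congr zero_le_one fun z hz => ?_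
      have hz1 : ‖z‖ = 1 := by simpa using hz
      have hz0 : z ≠ 0 := norm_ne_zero_iff.1 (by simp [hz1])
      have hzη : ∀ i, z ≠ η i := fun i h => (hη i).ne (h ▸ hz1)
      simp only [← logDeriv_pow_mul_prod_sub s η hz0 hzη, logDeriv_apply, hg]
    _ = _ := by
      rw [circleIntegral.integral_sub
          (f := fun z => s * (z - 0)⁻¹ + ∑ i, (z - η i)⁻¹) (hi0.add his) hig,
        circleIntegral_logDeriv_eq_zero hgd zero_le_one hg0, circleIntegral.integral_add hi0 his,
        circleIntegral.integral_const_mul, circleIntegral.integral_fun_sum hi,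
        circleIntegral.integral_sub_inv_of_mem_ball h0,
        Finset.sum_congr rfl fun i _ => circleIntegral.integral_sub_inv_of_mem_ball (hball i)]
      simp
      ring
end

section
/- Let M be an n×n complex matrix, v_in, v_out ∈ ℂⁿ, and λ ∈ ℂ with λ ≠ 0 and M - λI invertible. Define S = -⟨v_out, (M - λI)⁻¹ v_in⟩ and φ = -λ (M - λI)⁻¹ v_in. Define the linear map W on (ℕ → ℂ) × ℂⁿ × (ℕ → ℂ) by W(x, v, y) = (x', v', y') where x'(j) = x(j+1), v' = M v + x(0) • v_in, y'(0) = ⟨v_out, v⟩, and y'(j+1) = y(j). Then the element Ψ = ( j ↦ λ^{j+1}, φ, j ↦ S·λ^{-j} ) satisfies W Ψ = λ Ψ. -/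
open Matrix Complex

/-- One time step of a quantum walk on a graph (time-step operator `M` with the output
state deleted, input state `vin`, output state `vout`) attached to a runway: the incoming
amplitudes `x` advance toward the graph, `x 0` feeds into `vin`, the graph part evolves by
`M`, the amplitude `⟨vout, v⟩` is read onto the outgoing runway, and the outgoing
amplitudes advance away. -/
noncomputable def runwayStep {n : ℕ} (M : Matrix (Fin n) (Fin n) ℂ)
    (vin vout : Fin n → ℂ) :
    ((ℕ → ℂ) × (Fin n → ℂ) × (ℕ → ℂ)) → ((ℕ → ℂ) × (Fin n → ℂ) × (ℕ → ℂ)) :=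
  fun p =>
    (fun j => p.1 (j + 1),
     M.mulVec p.2.1 + p.1 0 • vin,
     fun j => Nat.casesOn j (star vout ⬝ᵥ p.2.1) fun j' => p.2.2 j')

/-- An incoming pure momentum signal `λ^{j+1}` together with the reflected signal
`S·λ^{-j}`, where `S = -⟨vout, (M - λI)⁻¹ vin⟩` is the effective scattering coefficient and
`φ = -λ(M - λI)⁻¹ vin` is the graph component, forms a `λ`-eigenstate of the walk. -/
theorem momentum_eigenstate {n : ℕ} (M : Matrix (Fin n) (Fin n) ℂ)
    (vin vout : Fin n → ℂ) (lam : ℂ) (hlam : lam ≠ 0)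
    (hinv : IsUnit (M - lam • (1 : Matrix (Fin n) (Fin n) ℂ))) :
    runwayStep M vin vout
        (fun j : ℕ => lam ^ (j + 1),
         (-lam) • (M - lam • 1)⁻¹.mulVec vin,
         fun j : ℕ => -(star vout ⬝ᵥ (M - lam • 1)⁻¹.mulVec vin) * lam ^ (-(j : ℤ)))
      = lam •
        (fun j : ℕ => lam ^ (j + 1),
         (-lam) • (M - lam • 1)⁻¹.mulVec vin,
         fun j : ℕ => -(star vout ⬝ᵥ (M - lam • 1)⁻¹.mulVec vin) * lam ^ (-(j : ℤ))) := by
  have hdet := (Matrix.isUnit_iff_isUnit_det _).mp hinv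
  have hres : M *ᵥ ((M - lam • 1)⁻¹ *ᵥ vin) = vin + lam • ((M - lam • 1)⁻¹ *ᵥ vin) := by
    have h : (M - lam • 1) *ᵥ ((M - lam • 1)⁻¹ *ᵥ vin) = vin := by
      rw [mulVec_mulVec, mul_nonsing_inv _ hdet, one_mulVec]
    rwa [sub_mulVec, smul_mulVec, one_mulVec, sub_eq_iff_eq_add] at h
  refine Prod.ext (funext fun j => ?_) (Prod.ext ?_ (funext fun j => ?_))
  · simp only [runwayStep, Prod.smul_fst, Pi.smul_apply, smul_eq_mul]
    ring
  · simp only [runwayStep, Prod.smul_fst, Prod.smul_snd, mulVec_smul, hres]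
    module
  · cases j with
    | zero =>
      simp [runwayStep, dotProduct_smul]
    | succ j =>
      simp only [runwayStep, Prod.smul_snd, Pi.smul_apply, smul_eq_mul, _root_.zpow_neg,
        zpow_natCast]
      field_simp
      ring
end

section
/- Fix s : ℕ, pairwise distinct nonzero complex numbers η₁, …, η_m with |η_j| < 1 for all j, and g₀ ∈ ℂ. Define f(z) = z^s ∏_{j=1}^m (z - η_j) and g(z) = g₀ ∏_{j=1}^m (1 - z · conj(η_j)). For an integer n ≥ s define h[n] = -(1/(2πi)) ∮_{|z|=1} z^{n-1} g(z)/f(z) dz (positively oriented unit circle). Then h[n] = Ω₀ · δ[n - s] + Σ_{j=1}^m Ω_j · η_j^n, where δ[n-s] is 1 if n = s and 0 otherwise, Ω₀ = -g₀ ∏_{k=1}^m (-1/η_k), and Ω_j = -g₀ · (1 - |η_j|²)/η_j^{s+1} · ∏_{k≠j} (1 - η_j · conj(η_k))/(η_j - η_k). -/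
open Complex

open Finset Metric in
/-- Residue theorem on a disc for a quotient with only simple poles. -/
theorem DifferentiableOn.circleIntegral_div_prod_sub {ι : Type*} [DecidableEq ι] {s : Finset ι}
    {v : ι → ℂ} {F : ℂ → ℂ} {c : ℂ} {R : ℝ} (hR : 0 < R)
    (hF : DifferentiableOn ℂ F (closedBall c R))
    (hv : ∀ i ∈ s, v i ∈ ball c R) (hinj : Set.InjOn v s) :
    (∮ z in C(c, R), F z / ∏ i ∈ s, (z - v i)) =
      2 * Real.pi * I * ∑ i ∈ s, Lagrange.nodalWeight s v i * F (v i) := by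
  rcases s.eq_empty_or_nonempty with rfl | hs
  · simpa using (hF.mono closure_ball_subset_closedBall).diffContOnCl.circleIntegral_eq_zero hR.le
  have hne : ∀ z ∈ sphere c R, ∀ i ∈ s, z ≠ v i := by
    rintro z hz i hi rfl
    exact (mem_ball.mp (hv i hi)).ne (mem_sphere.mp hz)
  have hpf : Set.EqOn (fun z => F z / ∏ i ∈ s, (z - v i))
      (fun z => ∑ i ∈ s, Lagrange.nodalWeight s v i * ((z - v i)⁻¹ • F z)) (sphere c R) := by
    intro z hz
    have h := Lagrange.eval_interpolate_not_at_node 1 (hne z hz)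
    rw [Lagrange.interpolate_one hinj hs, Polynomial.eval_one, Lagrange.eval_nodal] at h
    have h' : (∏ i ∈ s, (z - v i))⁻¹ = ∑ i ∈ s, Lagrange.nodalWeight s v i * (z - v i)⁻¹ := by
      simpa using inv_eq_of_mul_eq_one_right h.symm
    simp only [div_eq_mul_inv, h', mul_sum, smul_eq_mul]
    exact sum_congr rfl fun i _ => by ring
  rw [circleIntegral.integral_congr hR.le hpf, circleIntegral.integral_fun_sum, mul_sum]
  · refine sum_congr rfl fun i hi => ?_
    rw [circleIntegral.integral_const_mul, hF.circleIntegral_sub_inv_smul (hv i hi), smul_eq_mul]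
    ring
  · intro i hi
    refine ContinuousOn.circleIntegrable hR.le (continuousOn_const.mul (ContinuousOn.smul
      (ContinuousOn.inv₀ (by fun_prop) fun z hz => sub_ne_zero.mpr (hne z hz i hi))
      (hF.continuousOn.mono sphere_subset_closedBall)))

/-- The nodal weights after adjoining one more node, at an old node. -/
theorem Lagrange.nodalWeight_univ_option_some {ι K : Type*} [Fintype ι] [DecidableEq ι] [Field K]
    (v : Option ι → K) (j : ι) :
    Lagrange.nodalWeight Finset.univ v (some j) =
      (v (some j) - v none)⁻¹ * Lagrange.nodalWeight Finset.univ (v ∘ some) j := by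
  have h : (Finset.univ : Finset (Option ι)).erase (some j) =
      Finset.insertNone (Finset.univ.erase j) := by
    ext (_ | k) <;> simp
  simp [Lagrange.nodalWeight, h, Finset.prod_insertNone, mul_comm]

/-- The nodal weights after adjoining one more node, at the new node. -/
theorem Lagrange.nodalWeight_univ_option_none {ι K : Type*} [Fintype ι] [DecidableEq ι] [Field K]
    (v : Option ι → K) :
    Lagrange.nodalWeight Finset.univ v none = ∏ k, (v none - v (some k))⁻¹ := by
  have h : (Finset.univ : Finset (Option ι)).erase none =
      Finset.univ.map Function.Embedding.some := by
    ext (_ | k) <;> simp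
  simp [Lagrange.nodalWeight, h]

/-- Closed form of the impulse response of a single-runway graph:
`h[n] = -(1/2πi) ∮_{|z|=1} z^{n-1} g(z)/f(z) dz = Ω₀ δ[n-s] + Σⱼ Ωⱼ ηⱼⁿ`, where
`f(z) = z^s ∏ (z - ηⱼ)`, `g(z) = g₀ ∏ (1 - z·conj ηⱼ)`, the `ηⱼ` are pairwise distinct,
nonzero, and of modulus `< 1`, and `n ≥ s`. -/
theorem impulse_response_closed_form (s : ℕ) {m : ℕ} (η : Fin m → ℂ)
    (hη : ∀ j, ‖η j‖ < 1) (hη0 : ∀ j, η j ≠ 0) (hinj : Function.Injective η)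
    (g₀ : ℂ) (n : ℕ) (hn : s ≤ n) :
    -(1 / (2 * Real.pi * Complex.I)) *
        (∮ z in C(0, 1),
          z ^ ((n : ℤ) - 1) * (g₀ * ∏ j, (1 - z * (starRingEnd ℂ) (η j)))
            / (z ^ s * ∏ j, (z - η j)))
      = (-g₀ * ∏ k, (-1 / η k)) * (if n = s then 1 else 0)
        + ∑ j, (-g₀ * ((1 - (‖η j‖ : ℂ) ^ 2) / η j ^ (s + 1)) *
            ∏ k ∈ Finset.univ.erase j,
              (1 - η j * (starRingEnd ℂ) (η k)) / (η j - η k)) * η j ^ n := by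
  have hball : ∀ j, η j ∈ Metric.ball (0 : ℂ) 1 := fun j => by simpa using hη j
  have hpi : (2 * Real.pi * I : ℂ) ≠ 0 := Complex.two_pi_I_ne_zero
  set g : ℂ → ℂ := fun z => g₀ * ∏ j, (1 - z * (starRingEnd ℂ) (η j)) with hg
  have hgd : Differentiable ℂ g := by fun_prop
  have hnz : ∀ z ∈ Metric.sphere (0 : ℂ) 1, z ≠ 0 := fun z hz =>
    ne_zero_of_mem_unit_sphere ⟨z, hz⟩
  have hres : ∀ j, Lagrange.nodalWeight Finset.univ η j * g (η j) =
      g₀ * (1 - (‖η j‖ : ℂ) ^ 2) * ∏ k ∈ Finset.univ.erase j,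
        (1 - η j * (starRingEnd ℂ) (η k)) / (η j - η k) := fun j => by
    simp only [hg, Lagrange.nodalWeight]
    rw [← Finset.mul_prod_erase _ _ (Finset.mem_univ j), Complex.mul_conj', Finset.prod_div_distrib,
      Finset.prod_inv_distrib]
    ring
  rcases hn.eq_or_lt with rfl | hlt
  · let v : Option (Fin m) → ℂ := fun o => o.elim 0 η
    have hv : Function.Injective v := by
      rintro (_ | i) (_ | j) h
      · rfl
      · exact absurd h.symm (hη0 j)
      · exact absurd h (hη0 i)
      · exact congrArg some (hinj h)
    have hvb : ∀ o ∈ Finset.univ, v o ∈ Metric.ball (0 : ℂ) 1 := by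
      rintro (_ | i) _
      · simp [v]
      · exact hball i
    have hint := hgd.differentiableOn.circleIntegral_div_prod_sub one_pos hvb hv.injOn
    rw [circleIntegral.integral_congr zero_le_one (g := fun z => g z / ∏ o, (z - v o)), hint]
    · have hw : ∀ j, Lagrange.nodalWeight Finset.univ v (some j) * g (v (some j)) =
          (η j)⁻¹ * (Lagrange.nodalWeight Finset.univ η j * g (η j)) := fun j => by
        rw [Lagrange.nodalWeight_univ_option_some, mul_assoc]
        simp [v, Function.comp_def]
      have hw0 : Lagrange.nodalWeight Finset.univ v none * g (v none) =
          g₀ * ∏ k, (-1 / η k) := by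
        rw [Lagrange.nodalWeight_univ_option_none]
        simp [v, hg, mul_comm, neg_div, inv_neg]
      rw [Fintype.sum_option, hw0, neg_mul, ← mul_assoc, one_div_mul_cancel hpi, if_pos rfl,
        one_mul, neg_add, ← Finset.sum_neg_distrib]
      congr 1
      · ring
      · refine Finset.sum_congr rfl fun j _ => ?_
        rw [hw, hres]
        have := hη0 j
        field_simp
        ring
    · intro z hz
      have := hnz z hz
      simp only [Fintype.prod_option, v, Option.elim, sub_zero, zpow_sub_one₀ this, zpow_natCast, hg]
      field_simp
  · obtain ⟨d, rfl⟩ := Nat.exists_eq_add_of_lt hlt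
    have hint := DifferentiableOn.circleIntegral_div_prod_sub (F := fun z => z ^ d * g z) one_pos
      (by fun_prop) (fun j (_ : j ∈ Finset.univ) => hball j) hinj.injOn
    rw [circleIntegral.integral_congr zero_le_one
      (g := fun z => z ^ d * g z / ∏ j, (z - η j)), hint]
    · rw [neg_mul, ← mul_assoc, one_div_mul_cancel hpi, if_neg (by omega), one_mul, mul_zero,
        zero_add, ← Finset.sum_neg_distrib]
      refine Finset.sum_congr rfl fun j _ => ?_
      rw [mul_left_comm, hres]
      have := hη0 j
      field_simp
      ring
    · intro z hz
      have := hnz z hz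
      simp only [zpow_sub_one₀ this, zpow_natCast, hg]
      field_simp
      ring
end

section
/- Let M be an n×n complex matrix, and let (in_j)_{j=1}^p and (out_k)_{k=1}^p be two orthonormal families in ℂⁿ such that M*M = I - Σ_{k=1}^p out_k out_k* and M M* = I - Σ_{j=1}^p in_j in_j* (where w w* denotes the rank-one matrix v ↦ ⟨w, v⟩ w). Then for every λ ∈ ℂ with |λ| = 1 such that M - λI is invertible, and for every j, Σ_{k=1}^p |⟨out_k, (M - λI)⁻¹ in_j⟩|² = 1. -/
open Matrix Complex

/-- A matrix of the form `1 - ∑ⱼ wⱼ wⱼ*` with `w` orthonormal annihilates each `wⱼ`. -/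
theorem one_sub_sum_vecMulVec_mulVec_eq_zero {n p : ℕ} (w : Fin p → Fin n → ℂ)
    (hw : ∀ a b, star (w a) ⬝ᵥ w b = if a = b then 1 else 0) (j : Fin p) :
    (1 - ∑ k, vecMulVec (w k) (star (w k))) *ᵥ w j = 0 := by
  simp [sub_mulVec, sum_mulVec, vecMulVec_mulVec, hw]

/-- The quadratic form of `1 - ∑ₖ wₖ wₖ*` is `‖x‖² - ∑ₖ |⟨wₖ, x⟩|²`. -/
theorem dotProduct_one_sub_sum_vecMulVec_mulVec {n p : ℕ} (w : Fin p → Fin n → ℂ)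
    (x : Fin n → ℂ) :
    star x ⬝ᵥ ((1 - ∑ k, vecMulVec (w k) (star (w k))) *ᵥ x) =
      star x ⬝ᵥ x - ((∑ k, ‖star (w k) ⬝ᵥ x‖ ^ 2 : ℝ) : ℂ) := by
  have h (k : Fin p) : star x ⬝ᵥ w k = star (star (w k) ⬝ᵥ x) := by
    rw [star_dotProduct]
  simp only [sub_mulVec, one_mulVec, sum_mulVec, vecMulVec_mulVec, dotProduct_sub,
    dotProduct_sum, dotProduct_smul, op_smul_eq_smul, smul_eq_mul, h]
  push_cast
  simp only [← Complex.mul_conj', starRingEnd_apply]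

open scoped ComplexOrder in
/-- The matrices `A Aᴴ` and `Aᴴ` have the same kernel. -/
theorem complex_self_mul_conjTranspose_mulVec_eq_zero {n : ℕ} (A : Matrix (Fin n) (Fin n) ℂ)
    (v : Fin n → ℂ) : (A * Aᴴ) *ᵥ v = 0 ↔ Aᴴ *ᵥ v = 0 :=
  self_mul_conjTranspose_mulVec_eq_zero A v

/-- Unitarity of the scattering matrix: if `MᴴM = I - Σₖ outₖ outₖ*` and
`MMᴴ = I - Σⱼ inⱼ inⱼ*` for orthonormal families of input and output states, then for
every `λ` on the unit circle with `M - λI` invertible and every input `j`,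
`Σₖ |⟨outₖ, (M - λI)⁻¹ inⱼ⟩|² = 1`. -/
theorem scattering_row_norm_one {n p : ℕ} (M : Matrix (Fin n) (Fin n) ℂ)
    (inV outV : Fin p → Fin n → ℂ)
    (hin : ∀ a b, star (inV a) ⬝ᵥ inV b = if a = b then 1 else 0)
    (hout : ∀ a b, star (outV a) ⬝ᵥ outV b = if a = b then 1 else 0)
    (h1 : Mᴴ * M = 1 - ∑ k, vecMulVec (outV k) (star (outV k)))
    (h2 : M * Mᴴ = 1 - ∑ j, vecMulVec (inV j) (star (inV j)))
    (lam : ℂ) (hlam : ‖lam‖ = 1)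
    (hinv : IsUnit (M - lam • (1 : Matrix (Fin n) (Fin n) ℂ))) (j : Fin p) :
    ∑ k, ‖star (outV k) ⬝ᵥ (M - lam • 1)⁻¹.mulVec (inV j)‖ ^ 2 = 1 := by
  set b := inV j with hb
  set x := (M - lam • 1)⁻¹.mulVec b with hx
  have hMx : M *ᵥ x = lam • x + b := by
    have h : (M - lam • (1 : Matrix (Fin n) (Fin n) ℂ)) *ᵥ x = b := by
      rw [hx, mulVec_mulVec, mul_nonsing_inv _ ((isUnit_iff_isUnit_det _).mp hinv), one_mulVec]
    rw [sub_mulVec, smul_mulVec, one_mulVec] at h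
    rw [← h]
    abel
  have hMb : Mᴴ *ᵥ b = 0 := by
    rw [← complex_self_mul_conjTranspose_mulVec_eq_zero M, h2, one_sub_sum_vecMulVec_mulVec_eq_zero inV hin]
  have hbb : star b ⬝ᵥ b = 1 := by simp [hb, hin]
  have hbx : lam * (star b ⬝ᵥ x) = -1 := by
    have h : star b ⬝ᵥ (M *ᵥ x) = 0 := by
      rw [dotProduct_mulVec, ← conjTranspose_conjTranspose M, ← star_mulVec, hMb, star_zero,
        zero_dotProduct]
    rw [hMx, dotProduct_add, dotProduct_smul, hbb, smul_eq_mul] at h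
    exact eq_neg_of_add_eq_zero_left h
  have hxb : star lam * (star x ⬝ᵥ b) = -1 := by
    have h := congrArg star hbx
    rwa [star_mul', star_dotProduct, star_star, star_neg, star_one] at h
  have hll : star lam * lam = 1 := by
    rw [← starRingEnd_apply, Complex.conj_mul', hlam]
    simp
  have hnorm : star (M *ᵥ x) ⬝ᵥ (M *ᵥ x) = star x ⬝ᵥ x - 1 := by
    rw [hMx]
    simp only [star_add, star_smul, add_dotProduct, dotProduct_add, smul_dotProduct,
      dotProduct_smul, smul_eq_mul, hbb]
    linear_combination (star x ⬝ᵥ x) * hll + hxb + hbx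
  have key := dotProduct_one_sub_sum_vecMulVec_mulVec outV x
  rw [← h1, ← mulVec_mulVec, dotProduct_mulVec, ← star_mulVec, hnorm] at key
  exact_mod_cast (sub_right_injective key).symm
end

section
/- Let M be an n×n complex matrix, v_in, v_out ∈ ℂⁿ, and define the linear map W on (ℕ → ℂ) × ℂⁿ × (ℕ → ℂ) by W(x, v, y) = (x', v', y') where x'(j) = x(j+1), v' = M v + x(0) • v_in, y'(0) = ⟨v_out, v⟩, and y'(j+1) = y(j). Then for every finitely supported x : ℕ → ℂ and every integer n ≥ 1, the first outgoing coordinate of W^{n+1}(x, 0, 0) equals the convolution (x * h)[n] := Σ_{k=1}^{n} h[k] · x(n - k), where h[k] = ⟨v_out, M^{k-1} v_in⟩ for k ≥ 1. -/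
open Matrix Complex

theorem runwayStep_snd_snd_zero {n : ℕ} (M : Matrix (Fin n) (Fin n) ℂ)
    (vin vout : Fin n → ℂ) (p : (ℕ → ℂ) × (Fin n → ℂ) × (ℕ → ℂ)) :
    (runwayStep M vin vout p).2.2 0 = star vout ⬝ᵥ p.2.1 := rfl

theorem iterate_runwayStep_fst {n : ℕ} (M : Matrix (Fin n) (Fin n) ℂ)
    (vin vout : Fin n → ℂ) (p : (ℕ → ℂ) × (Fin n → ℂ) × (ℕ → ℂ)) (N j : ℕ) :
    ((runwayStep M vin vout)^[N] p).1 j = p.1 (j + N) := by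
  induction N generalizing j with
  | zero => rfl
  | succ N ih =>
    rw [Function.iterate_succ_apply']
    change ((runwayStep M vin vout)^[N] p).1 (j + 1) = _
    rw [ih, Nat.add_right_comm, Nat.add_assoc]

/-- The graph part of the state after `N` steps, starting from an empty graph. -/
theorem iterate_runwayStep_snd_fst {n : ℕ} (M : Matrix (Fin n) (Fin n) ℂ)
    (vin vout : Fin n → ℂ) (x y : ℕ → ℂ) (N : ℕ) :
    ((runwayStep M vin vout)^[N] (x, 0, y)).2.1
      = ∑ k ∈ Finset.range N, x (N - 1 - k) • (M ^ k).mulVec vin := by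
  induction N with
  | zero => simp
  | succ N ih =>
    rw [Function.iterate_succ_apply']
    change M.mulVec ((runwayStep M vin vout)^[N] (x, 0, y)).2.1
      + ((runwayStep M vin vout)^[N] (x, 0, y)).1 0 • vin = _
    rw [ih, iterate_runwayStep_fst, Finset.sum_range_succ', mulVec_sum]
    congr 1
    · refine Finset.sum_congr rfl fun k _ => ?_
      rw [mulVec_smul, mulVec_mulVec, ← pow_succ', Nat.add_sub_cancel, Nat.sub_sub,
        Nat.add_comm 1 k]
    · simp

/-- The response to an arbitrary (finitely supported) input signal `x` is the convolution
of `x` with the impulse response `h[k] = ⟨vout, M^{k-1} vin⟩`: the first outgoing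
coordinate after `n+1` steps equals `Σ_{k=1}^{n} h[k]·x(n-k)`. -/
theorem response_is_convolution {n : ℕ} (M : Matrix (Fin n) (Fin n) ℂ)
    (vin vout : Fin n → ℂ) (x : ℕ → ℂ) (hx : (Function.support x).Finite)
    (N : ℕ) (hN : 1 ≤ N) :
    ((runwayStep M vin vout)^[N + 1] (x, 0, 0)).2.2 0
      = ∑ k ∈ Finset.Icc 1 N,
          (star vout ⬝ᵥ (M ^ (k - 1)).mulVec vin) * x (N - k) := by
  rw [Function.iterate_succ_apply']
  simp only [runwayStep_snd_snd_zero, iterate_runwayStep_snd_fst]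
  rw [← Finset.Ico_add_one_right_eq_Icc, Finset.sum_Ico_eq_sum_range, dotProduct_sum,
    Nat.add_sub_cancel]
  refine Finset.sum_congr rfl fun k _ => ?_
  rw [dotProduct_smul, smul_eq_mul, mul_comm, Nat.add_sub_cancel_left, Nat.sub_sub]
end
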